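/- arXiv:math/0608263 — 2 statements merged into one kernel-verified Lean document; each statement's English description precedes it below -/
import Mathlib

section
/- Let q ∈ (G, q_KL) be a transcendental real number, where G = (1+√5)/2 and q_KL is the Komornik–Loreti constant. Then for every x ∈ [0, 1/(q-1)], the set of expansions of x in base q either has exactly one element or has the cardinality of the continuum (2^ℵ₀). -/
noncomputable section

/-- `a` is an expansion of `x` in base `q`: all digits `a n` lie in `{0,1}` and
`x = Σ_{n≥1} a_n q^{-n}` (here `a n` is the `(n+1)`-st digit, i.e. indexing is 0-based). -/
def IsExpansion (q x : ℝ) (a : ℕ → ℕ) : Prop :=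
  (∀ n, a n ≤ 1) ∧ x = ∑' n : ℕ, (a n : ℝ) / q ^ (n + 1)

/-- The set of expansions of `x` in base `q`. -/
def expansionsOf (q x : ℝ) : Set (ℕ → ℕ) := {a | IsExpansion q x a}

/-- `U_q`: the set of `x ∈ [0, 1/(q-1)]` having a unique expansion in base `q`. -/
def uniqueExpansionSet (q : ℝ) : Set ℝ :=
  {x | x ∈ Set.Icc 0 (1 / (q - 1)) ∧ ∃! a, IsExpansion q x a}

/-- `B_m` (for finite `m`): bases `q ∈ (G, 2)` for which some `x ∈ I_q` has exactly `m`
expansions in base `q`. -/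
def B (m : ℕ) : Set ℝ :=
  {q | q ∈ Set.Ioo ((1 + Real.sqrt 5) / 2) 2 ∧
    ∃ x ∈ Set.Icc (0:ℝ) (1 / (q - 1)), Cardinal.mk (expansionsOf q x) = m}

/-- `B_{ℵ₀}`: bases `q ∈ (G, 2)` for which some `x ∈ I_q` has exactly countably infinitely
many expansions in base `q`. -/
def Baleph0 : Set ℝ :=
  {q | q ∈ Set.Ioo ((1 + Real.sqrt 5) / 2) 2 ∧
    ∃ x ∈ Set.Icc (0:ℝ) (1 / (q - 1)), Cardinal.mk (expansionsOf q x) = Cardinal.aleph0}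

/-- The Thue–Morse sequence: `thueMorse n` is the parity of the number of 1s in the
binary expansion of `n`. -/
def thueMorse (n : ℕ) : ℕ := ((Nat.digits 2 n).count 1) % 2

/-- A digit `a m` of an expansion of `x` in base `q` is forced if every expansion of `x`
agreeing with `a` before position `m` also agrees at position `m`. -/
def Forced (q x : ℝ) (a : ℕ → ℕ) (m : ℕ) : Prop :=
  ∀ c : ℕ → ℕ, IsExpansion q x c → (∀ i < m, c i = a i) → c m = a m

theorem thueMorse_two_mul (n : ℕ) : thueMorse (2 * n) = thueMorse n := by
  rcases Nat.eq_zero_or_pos n with rfl | hn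
  · rfl
  · simp [thueMorse, Nat.digits_def' one_lt_two (Nat.mul_pos two_pos hn)]

theorem thueMorse_two_mul_add_one (n : ℕ) : thueMorse (2 * n + 1) = 1 - thueMorse n := by
  have h : (2 * n + 1) / 2 = n := by omega
  simp only [thueMorse, Nat.digits_def' one_lt_two (Nat.succ_pos (2 * n)), h,
    List.count_cons]
  simp
  omega

/-- The Thue–Morse sequence with values in `Bool`. -/
def thueMorseBool (n : ℕ) : Bool := decide (thueMorse n = 1)

theorem toNat_decide_eq_one {n : ℕ} (hn : n ≤ 1) : (decide (n = 1)).toNat = n := by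
  interval_cases n <;> rfl

theorem toNat_thueMorseBool (n : ℕ) : (thueMorseBool n).toNat = thueMorse n :=
  toNat_decide_eq_one (Nat.le_of_lt_succ (Nat.mod_lt _ two_pos))

theorem thueMorseBool_zero : thueMorseBool 0 = false := by
  simp [thueMorseBool, thueMorse]

theorem thueMorseBool_two_mul (n : ℕ) : thueMorseBool (2 * n) = thueMorseBool n := by
  simp only [thueMorseBool, thueMorse_two_mul]

theorem thueMorseBool_two_mul_add_one (n : ℕ) :
    thueMorseBool (2 * n + 1) = !thueMorseBool n := by
  have h : thueMorse n < 2 := Nat.mod_lt _ two_pos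
  simp only [thueMorseBool, thueMorse_two_mul_add_one]
  interval_cases thueMorse n <;> rfl

theorem thueMorseBool_one : thueMorseBool 1 = true := by
  simpa [thueMorseBool_zero] using thueMorseBool_two_mul_add_one 0

theorem thueMorseBool_two : thueMorseBool 2 = true := by
  simpa [thueMorseBool_one] using thueMorseBool_two_mul 1

theorem thueMorseBool_three : thueMorseBool 3 = false := by
  simpa [thueMorseBool_one] using thueMorseBool_two_mul_add_one 1

theorem thueMorseBool_five : thueMorseBool 5 = false := by
  simpa [thueMorseBool_two] using thueMorseBool_two_mul_add_one 2

theorem thueMorseBool_six : thueMorseBool 6 = false := by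
  simpa [thueMorseBool_three] using thueMorseBool_two_mul 3

/-- The tail of `a` from position `n` on, complemented when `a n` is `true`, is
lexicographically smaller than the Thue–Morse sequence, the first difference being at `j`. -/
def BelowThueMorseAt (a : ℕ → Bool) (n j : ℕ) : Prop :=
  (∀ i < j, a (n + i) = (a n ^^ thueMorseBool i)) ∧ a (n + j) = a n ∧ thueMorseBool j = true

/-- The sequence `a` is periodic from some index on. -/
def EventuallyPeriodic (a : ℕ → Bool) : Prop :=
  ∃ N p, 0 < p ∧ ∀ n ≥ N, a (n + p) = a n

theorem BelowThueMorseAt.pos {a : ℕ → Bool} {n j : ℕ} (h : BelowThueMorseAt a n j) : 0 < j := by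
  rcases Nat.eq_zero_or_pos j with rfl | hj
  · simp [BelowThueMorseAt, thueMorseBool_zero] at h
  · exact hj

theorem thueMorseBool_shift_le (n : ℕ) :
    (∀ i, thueMorseBool (n + i) = (thueMorseBool n ^^ thueMorseBool i)) ∨
      ∃ j, BelowThueMorseAt thueMorseBool n j := by
  induction n using Nat.strong_induction_on with
  | _ n ih =>
    rcases Nat.eq_zero_or_pos n with rfl | hn
    · left; simp [thueMorseBool_zero]
    rcases Nat.even_or_odd' n with ⟨k, rfl | rfl⟩
    · have key (i : ℕ) (h : thueMorseBool (k + i / 2) = (thueMorseBool k ^^ thueMorseBool (i / 2))) :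
          thueMorseBool (2 * k + i) = (thueMorseBool (2 * k) ^^ thueMorseBool i) := by
        rcases Nat.even_or_odd' i with ⟨l, rfl | rfl⟩
        · rw [show 2 * l / 2 = l by omega] at h
          rw [← mul_add, thueMorseBool_two_mul, thueMorseBool_two_mul, thueMorseBool_two_mul, h]
        · rw [show (2 * l + 1) / 2 = l by omega] at h
          rw [← add_assoc, ← mul_add, thueMorseBool_two_mul_add_one, thueMorseBool_two_mul,
            thueMorseBool_two_mul_add_one, h, Bool.xor_not]
      rcases ih k (by omega) with h | ⟨j, h₁, h₂, h₃⟩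
      · exact Or.inl fun i => key i (h _)
      · refine Or.inr ⟨2 * j, fun i hi => key i (h₁ _ (by omega)), ?_, ?_⟩
        · rw [← mul_add, thueMorseBool_two_mul, thueMorseBool_two_mul, h₂]
        · rw [thueMorseBool_two_mul, h₃]
    · right
      have h₁ := thueMorseBool_two_mul (k + 1)
      have h₂ := thueMorseBool_two_mul_add_one (k + 1)
      by_cases h : thueMorseBool (2 * k + 1 + 1) = thueMorseBool (2 * k + 1)
      · refine ⟨1, fun i hi => ?_, h, thueMorseBool_one⟩
        obtain rfl : i = 0 := by omega
        simp [thueMorseBool_zero]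
      · refine ⟨2, fun i hi => ?_, ?_, thueMorseBool_two⟩
        · interval_cases i
          · simp [thueMorseBool_zero]
          · rw [thueMorseBool_one, Bool.xor_true, Bool.eq_not]
            exact h
        · rw [show 2 * k + 1 + 2 = 2 * (k + 1) + 1 by ring, h₂, ← h₁,
            show 2 * (k + 1) = 2 * k + 1 + 1 by ring, Bool.not_eq]
          exact h

theorem BelowThueMorseAt.of_run {a : ℕ → Bool} {n j : ℕ} (h : BelowThueMorseAt a n j)
    (h₁ : a (n + 1) ≠ a n) (h₂ : a (n + 2) ≠ a n) :
    a (n + 3) = a n ∧ (a (n + 4) ≠ a n → a (n + 5) = a n ∧ a (n + 6) = a n) := by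
  have hpos := h.pos
  obtain ⟨hlt, hj, ht⟩ := h
  have hj1 : j ≠ 1 := by rintro rfl; exact h₁ hj
  have hj2 : j ≠ 2 := by rintro rfl; exact h₂ hj
  have hj3 : j ≠ 3 := by rintro rfl; simp [thueMorseBool_three] at ht
  refine ⟨by simpa [thueMorseBool_three] using hlt 3 (by omega), fun h₄ => ?_⟩
  have hj4 : j ≠ 4 := by rintro rfl; exact h₄ hj
  have hj5 : j ≠ 5 := by rintro rfl; simp [thueMorseBool_five] at ht
  have hj6 : j ≠ 6 := by rintro rfl; simp [thueMorseBool_six] at ht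
  exact ⟨by simpa [thueMorseBool_five] using hlt 5 (by omega),
    by simpa [thueMorseBool_six] using hlt 6 (by omega)⟩

/-- In a sequence all of whose tails lie below the Thue–Morse sequence, everything after the
beginning of a run of length two is a concatenation of the blocks `01` and `10`. -/
theorem ne_succ_of_run {a : ℕ → Bool} (ha : ∀ n, ∃ j, BelowThueMorseAt a n j) (t : ℕ) :
    ∀ n, a (n + 1) ≠ a n → a (n + 2) = a (n + 1) → a (n + 2 * t + 3) ≠ a (n + 2 * t + 2) := by
  induction t using Nat.strong_induction_on with
  | _ t ih =>
    intro n h₁ h₂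
    obtain ⟨j, hj⟩ := ha n
    obtain ⟨h₃, h₅⟩ := hj.of_run h₁ (h₂ ▸ h₁)
    have h₂₃ : a (n + 3) ≠ a (n + 2) := by rw [h₃, h₂]; exact h₁.symm
    rcases t with _ | t
    · exact h₂₃
    by_cases h₄ : a (n + 4) = a n
    · have := ih t (by omega) (n + 2) h₂₃ (h₄.trans h₃.symm)
      rwa [show n + 2 + 2 * t = n + 2 * (t + 1) by ring] at this
    · obtain ⟨h₅, h₆⟩ := h₅ h₄
      have h₄₅ : a (n + 5) ≠ a (n + 4) := by rw [h₅]; exact Ne.symm h₄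
      rcases t with _ | t
      · exact h₄₅
      have := ih t (by omega) (n + 4) h₄₅ (h₆.trans h₅.symm)
      rwa [show n + 4 + 2 * t = n + 2 * (t + 1 + 1) by ring] at this

theorem eventuallyPeriodic_of_below (k : ℕ) :
    ∀ a : ℕ → Bool, (∀ n, ∃ j < 2 ^ k, BelowThueMorseAt a n j) → EventuallyPeriodic a := by
  induction k with
  | zero =>
    intro a ha
    obtain ⟨j, hj, h⟩ := ha 0
    have := h.pos
    omega
  | succ k ih =>
    intro a ha
    by_cases hrun : ∃ n, a (n + 1) ≠ a n ∧ a (n + 2) = a (n + 1)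
    · obtain ⟨p, hp₁, hp₂⟩ := hrun
      have hne (t : ℕ) : a (p + 2 + 2 * t + 1) = !a (p + 2 + 2 * t) := by
        have := ne_succ_of_run (fun n => (ha n).imp fun j hj => hj.2) t p hp₁ hp₂
        rw [Bool.eq_not]
        convert this using 2 <;> ring_nf
      obtain ⟨N, r, hr, hper⟩ := ih (fun t => a (p + 2 + 2 * t)) fun n => by
        obtain ⟨j, hj, h₁, h₂, h₃⟩ := ha (p + 2 + 2 * n)
        rcases Nat.even_or_odd' j with ⟨l, rfl | rfl⟩
        · refine ⟨l, by omega, fun i hi => ?_, ?_, by rwa [thueMorseBool_two_mul] at h₃⟩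
          · have := h₁ (2 * i) (by omega)
            rwa [thueMorseBool_two_mul, add_assoc (p + 2), ← mul_add] at this
          · rwa [add_assoc (p + 2), ← mul_add] at h₂
        · have h := h₁ (2 * l) (by omega)
          rw [thueMorseBool_two_mul] at h
          rw [thueMorseBool_two_mul_add_one] at h₃
          have h' := hne (n + l)
          rw [mul_add, ← add_assoc, h] at h'
          rw [← add_assoc, h'] at h₂
          revert h₂ h₃
          cases a (p + 2 + 2 * n) <;> cases thueMorseBool l <;> simp
      refine ⟨p + 2 + 2 * N, 2 * r, by omega, fun n hn => ?_⟩
      obtain ⟨m, rfl⟩ : ∃ m, n = p + 2 + m := ⟨n - (p + 2), by omega⟩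
      rcases Nat.even_or_odd' m with ⟨l, rfl | rfl⟩
      · rw [add_assoc (p + 2), ← mul_add]
        exact hper l (by omega)
      · rw [show p + 2 + (2 * l + 1) + 2 * r = p + 2 + 2 * (l + r) + 1 by ring, ← add_assoc,
          hne, hne]
        exact congrArg _ (hper l (by omega))
    · push Not at hrun
      by_cases hconst : ∃ n, a (n + 1) ≠ a n
      · obtain ⟨n, hn⟩ := hconst
        have halt (i : ℕ) : a (n + i + 1) ≠ a (n + i) := by
          induction i with
          | zero => exact hn
          | succ i hi => exact hrun _ hi
        refine ⟨n, 2, two_pos, fun m hm => ?_⟩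
        obtain ⟨i, rfl⟩ := Nat.exists_eq_add_of_le hm
        have h₁ := halt i
        have h₂ := halt (i + 1)
        rw [← Bool.eq_not] at h₁ h₂
        rw [← add_assoc] at h₂
        rw [show n + i + 2 = n + i + 1 + 1 by ring, h₂, h₁, Bool.not_not]
      · push Not at hconst
        exact ⟨0, 1, one_pos, fun n _ => hconst n⟩

/-- The value in base `q` of a sequence of binary digits. -/
def digitSum (q : ℝ) (a : ℕ → Bool) : ℝ := ∑' n, ((a n).toNat : ℝ) / q ^ (n + 1)

theorem digit_term_le {q : ℝ} (hq : 1 < q) (b : Bool) (n : ℕ) :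
    (b.toNat : ℝ) / q ^ (n + 1) ≤ q⁻¹ ^ (n + 1) := by
  rw [inv_pow, ← one_div]
  gcongr
  cases b <;> simp

theorem hasSum_inv_pow_succ {q : ℝ} (hq : 1 < q) :
    HasSum (fun n : ℕ => q⁻¹ ^ (n + 1)) (1 / (q - 1)) := by
  have h := (hasSum_geometric_of_lt_one (inv_nonneg.2 (by linarith))
    (inv_lt_one_of_one_lt₀ hq)).mul_left q⁻¹
  have hq' : q - 1 ≠ 0 := by linarith
  have hq0 : q ≠ 0 := by linarith
  have hval : q⁻¹ * (1 - q⁻¹)⁻¹ = 1 / (q - 1) := by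
    rw [← mul_inv, mul_sub, mul_one, mul_inv_cancel₀ hq0, one_div]
  simpa only [hval, ← pow_succ'] using h

theorem summable_digits {q : ℝ} (hq : 1 < q) (a : ℕ → Bool) :
    Summable fun n => ((a n).toNat : ℝ) / q ^ (n + 1) :=
  .of_nonneg_of_le (fun n => by positivity) (fun n => digit_term_le hq (a n) n)
    (hasSum_inv_pow_succ hq).summable

theorem digitSum_nonneg {q : ℝ} (hq : 1 < q) (a : ℕ → Bool) : 0 ≤ digitSum q a :=
  tsum_nonneg fun n => by positivity

theorem digitSum_le {q : ℝ} (hq : 1 < q) (a : ℕ → Bool) : digitSum q a ≤ 1 / (q - 1) :=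
  hasSum_le (fun n => digit_term_le hq (a n) n) (summable_digits hq a).hasSum
    (hasSum_inv_pow_succ hq)

theorem digitSum_not {q : ℝ} (hq : 1 < q) (a : ℕ → Bool) :
    digitSum q (fun n => !a n) = 1 / (q - 1) - digitSum q a := by
  refine Eq.trans (tsum_congr fun n => ?_)
    ((hasSum_inv_pow_succ hq).sub (summable_digits hq a).hasSum).tsum_eq
  cases h : a n <;> simp [h]

theorem sum_le_digitSum {q : ℝ} (hq : 1 < q) (a : ℕ → Bool) (n : ℕ) :
    ∑ i ∈ Finset.range n, ((a i).toNat : ℝ) / q ^ (i + 1) ≤ digitSum q a :=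
  (summable_digits hq a).sum_le_tsum _ fun i _ => by positivity

theorem digitSum_eq_sum_add {q : ℝ} (hq : 1 < q) (a : ℕ → Bool) (n : ℕ) :
    digitSum q a = ∑ i ∈ Finset.range n, ((a i).toNat : ℝ) / q ^ (i + 1) +
      digitSum q (fun i => a (n + i)) / q ^ n := by
  rw [digitSum, ← (summable_digits hq a).sum_add_tsum_nat_add n, digitSum, ← tsum_div_const]
  congr 2
  funext i
  rw [div_div, ← pow_add, add_comm i n, add_right_comm i 1 n, add_comm i n]

theorem digitSum_succ {q : ℝ} (hq : 1 < q) (a : ℕ → Bool) :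
    digitSum q a = ((a 0).toNat + digitSum q (fun i => a (1 + i))) / q := by
  rw [digitSum_eq_sum_add hq a 1]
  simp [add_div]

theorem continuous_digitSum {q : ℝ} (hq : 1 < q) : Continuous (digitSum q) := by
  refine continuous_tsum (fun n => ?_) (hasSum_inv_pow_succ hq).summable fun n a => ?_
  · exact (continuous_of_discreteTopology
      (f := fun b : Bool => (b.toNat : ℝ) / q ^ (n + 1))).comp (continuous_apply n)
  · rw [Real.norm_of_nonneg (by positivity)]
    exact digit_term_le hq (a n) n

theorem exists_digitSum_eq {q y : ℝ} (hq : 1 < q) (hq2 : q ≤ 2)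
    (hy : y ∈ Set.Icc 0 (1 / (q - 1))) : ∃ a, digitSum q a = y := by
  have hq1 : 0 < q - 1 := by linarith
  let r : ℕ → ℝ := Nat.rec y fun _ s => if 1 ≤ q * s then q * s - 1 else q * s
  have hr_succ (n : ℕ) : r (n + 1) = if 1 ≤ q * r n then q * r n - 1 else q * r n := rfl
  have hr (n : ℕ) : 0 ≤ r n ∧ r n ≤ 1 / (q - 1) := by
    induction n with
    | zero => exact hy
    | succ n ih =>
      rw [le_div_iff₀ hq1] at ih ⊢
      rw [hr_succ]
      split_ifs with h
      · exact ⟨by linarith, by nlinarith⟩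
      · exact ⟨mul_nonneg (by linarith) ih.1, by nlinarith⟩
  let a : ℕ → Bool := fun n => decide (1 ≤ q * r n)
  have hsum (n : ℕ) :
      ∑ i ∈ Finset.range n, ((a i).toNat : ℝ) / q ^ (i + 1) = y - r n * q⁻¹ ^ n := by
    induction n with
    | zero => simp [r]
    | succ n ih =>
      rw [Finset.sum_range_succ, ih, hr_succ, inv_pow, inv_pow]
      have hq0 : q ≠ 0 := by linarith
      by_cases h : 1 ≤ q * r n <;> simp only [a, h, decide_true, decide_false, if_true, if_false,
        Bool.toNat_true, Bool.toNat_false, Nat.cast_one, Nat.cast_zero] <;> field_simp <;> ring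
  refine ⟨a, tendsto_nhds_unique (summable_digits hq a).hasSum.tendsto_sum_nat ?_⟩
  simp_rw [hsum]
  have hpow : Filter.Tendsto (fun n : ℕ => 1 / (q - 1) * q⁻¹ ^ n) Filter.atTop (nhds 0) := by
    simpa using (tendsto_pow_atTop_nhds_zero_of_lt_one (inv_nonneg.2 (by linarith))
      (inv_lt_one_of_one_lt₀ hq)).const_mul (1 / (q - 1))
  have hpos : 0 ≤ q⁻¹ := inv_nonneg.2 (by linarith)
  have h0 : Filter.Tendsto (fun n : ℕ => r n * q⁻¹ ^ n) Filter.atTop (nhds 0) :=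
    squeeze_zero (fun n => mul_nonneg (hr n).1 (pow_nonneg hpos n))
      (fun n => mul_le_mul_of_nonneg_right (hr n).2 (pow_nonneg hpos n)) hpow
  simpa using h0.const_sub y

/-- In the base in which the shifted Thue–Morse sequence represents `1`, every tail of the
Thue–Morse sequence following a digit `0` has value at most `1`. -/
theorem digitSum_thueMorseBool_tail_le_one {Q : ℝ} (hQ : 1 < Q)
    (h1 : digitSum Q (fun i => thueMorseBool (1 + i)) = 1) {n : ℕ} (hn : thueMorseBool n = false) :
    digitSum Q (fun i => thueMorseBool (n + 1 + i)) ≤ 1 := by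
  have hQ0 : 0 < Q := by linarith
  have hC : 0 ≤ 1 / (Q - 1) := one_div_nonneg.2 (by linarith)
  have key (k : ℕ) : ∀ n, thueMorseBool n = false →
      digitSum Q (fun i => thueMorseBool (n + 1 + i)) - 1 ≤ 1 / (Q - 1) * Q⁻¹ ^ k := by
    induction k with
    | zero =>
      intro n _
      have := digitSum_le hQ fun i => thueMorseBool (n + 1 + i)
      rw [pow_zero, mul_one]
      linarith
    | succ k ih =>
      intro n hn
      rcases thueMorseBool_shift_le n with h | ⟨j, hj⟩
      · have : (fun i => thueMorseBool (n + 1 + i)) = fun i => thueMorseBool (1 + i) := by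
          funext i
          rw [add_assoc, h, hn, Bool.false_xor]
        rw [this, h1, sub_self]
        positivity
      · obtain ⟨l, rfl⟩ := Nat.exists_eq_add_of_le' hj.pos
        obtain ⟨hlt, hl, ht⟩ := hj
        have e₁ := digitSum_eq_sum_add hQ (fun i => thueMorseBool (n + 1 + i)) (l + 1)
        have e₂ := digitSum_eq_sum_add hQ (fun i => thueMorseBool (1 + i)) (l + 1)
        have hsum : ∑ i ∈ Finset.range l, ((thueMorseBool (n + 1 + i)).toNat : ℝ) / Q ^ (i + 1) =
            ∑ i ∈ Finset.range l, ((thueMorseBool (1 + i)).toNat : ℝ) / Q ^ (i + 1) := by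
          refine Finset.sum_congr rfl fun i hi => ?_
          rw [add_assoc, hlt _ (by have := Finset.mem_range.1 hi; omega), hn, Bool.false_xor]
        rw [Finset.sum_range_succ, hsum, add_assoc n 1 l, add_comm 1 l, hl, hn] at e₁
        rw [h1, Finset.sum_range_succ, add_comm 1 l, ht] at e₂
        have hnn := digitSum_nonneg hQ fun i => thueMorseBool (1 + (l + 1 + i))
        have hih := ih (n + (l + 1)) (hl.trans hn)
        have e₃ : (fun i => thueMorseBool (n + 1 + (l + 1 + i))) =
            fun i => thueMorseBool (n + (l + 1) + 1 + i) := by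
          funext i; ring_nf
        rw [e₃] at e₁
        set T := digitSum Q fun i => thueMorseBool (n + (l + 1) + 1 + i)
        have hle : digitSum Q (fun i => thueMorseBool (n + 1 + i)) - 1 ≤ (T - 1) / Q ^ (l + 1) := by
          have := div_nonneg hnn (pow_nonneg hQ0.le (l + 1))
          simp only [Bool.toNat_true, Bool.toNat_false, Nat.cast_one, Nat.cast_zero,
            zero_div] at e₁ e₂
          rw [sub_div]
          linarith
        calc _ ≤ (T - 1) / Q ^ (l + 1) := hle
          _ ≤ (1 / (Q - 1) * Q⁻¹ ^ k) / Q ^ (l + 1) := by gcongr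
          _ ≤ (1 / (Q - 1) * Q⁻¹ ^ k) / Q := by
              gcongr
              exact le_self_pow₀ hQ.le (Nat.succ_ne_zero l)
          _ = _ := by rw [pow_succ, div_eq_mul_inv, mul_assoc]
  have hlim : Filter.Tendsto (fun k : ℕ => 1 / (Q - 1) * Q⁻¹ ^ k) Filter.atTop (nhds 0) := by
    simpa using (tendsto_pow_atTop_nhds_zero_of_lt_one (inv_nonneg.2 hQ0.le)
      (inv_lt_one_of_one_lt₀ hQ)).const_mul (1 / (Q - 1))
  have := ge_of_tendsto' hlim fun k => key k n hn
  linarith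

theorem exists_one_lt_sum_thueMorseBool {q Q : ℝ} (hq : 1 < q) (hqQ : q < Q)
    (h1 : digitSum Q (fun i => thueMorseBool (1 + i)) = 1) :
    ∃ N, 1 < ∑ i ∈ Finset.range N, ((thueMorseBool (1 + i)).toNat : ℝ) / q ^ (i + 1) := by
  have hQ : 1 < Q := hq.trans hqQ
  have hlt : 1 < digitSum q (fun i => thueMorseBool (1 + i)) := by
    rw [← h1]
    refine Summable.tsum_lt_tsum (i := 0) (fun i => ?_) ?_ (summable_digits hQ _)
      (summable_digits hq _)
    · gcongr
    · simpa [thueMorseBool_one] using inv_strictAnti₀ (by linarith) hqQ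
  exact ((summable_digits hq _).hasSum.tendsto_sum_nat.eventually (lt_mem_nhds hlt)).exists

theorem belowThueMorseAt_not {a : ℕ → Bool} {n j : ℕ} :
    BelowThueMorseAt (fun i => !a i) n j ↔ BelowThueMorseAt a n j := by
  simp [BelowThueMorseAt]

theorem exists_belowThueMorseAt {q Q : ℝ} (hq : 1 < q) (hqQ : q < Q)
    (h1 : digitSum Q (fun i => thueMorseBool (1 + i)) = 1) {N : ℕ}
    (hN : 1 < ∑ i ∈ Finset.range N, ((thueMorseBool (1 + i)).toNat : ℝ) / q ^ (i + 1))
    {a : ℕ → Bool} {n : ℕ} (hn : a n = false) (ha : digitSum q (fun i => a (n + 1 + i)) < 1) :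
    ∃ j < N + 1, BelowThueMorseAt a n j := by
  have hQ : 1 < Q := hq.trans hqQ
  have hsum (l : ℕ) (h : ∀ i < l + 1, a (n + i) = thueMorseBool i) :
      ∑ i ∈ Finset.range l, ((a (n + 1 + i)).toNat : ℝ) / q ^ (i + 1) =
        ∑ i ∈ Finset.range l, ((thueMorseBool (1 + i)).toNat : ℝ) / q ^ (i + 1) :=
    Finset.sum_congr rfl fun i hi => by
      rw [add_assoc, h _ (by have := Finset.mem_range.1 hi; omega)]
  by_cases hall : ∀ i < N + 1, a (n + i) = thueMorseBool i
  · have := sum_le_digitSum hq (fun i => a (n + 1 + i)) N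
    rw [hsum N hall] at this
    linarith
  · push Not at hall
    classical
    obtain ⟨hjN, hj⟩ := Nat.find_spec hall
    have hmin (i : ℕ) (hi : i < Nat.find hall) : a (n + i) = thueMorseBool i := by
      by_contra h
      exact Nat.find_min hall hi ⟨hi.trans hjN, h⟩
    generalize Nat.find hall = j at hjN hj hmin
    cases ht : thueMorseBool j with
    | true =>
      refine ⟨j, hjN, fun i hi => by rw [hmin i hi, hn, Bool.false_xor], ?_, ht⟩
      rw [ht] at hj
      simpa [hn] using hj
    | false =>
      exfalso
      have haj : a (n + j) = true := by simpa [ht] using hj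
      rcases j with _ | l
      · simp [hn] at haj
      have htail := digitSum_thueMorseBool_tail_le_one hQ h1 ht
      have e := digitSum_eq_sum_add hQ (fun i => thueMorseBool (1 + i)) (l + 1)
      have hle := sum_le_digitSum hq (fun i => a (n + 1 + i)) (l + 1)
      rw [Finset.sum_range_succ, hsum l hmin, add_assoc n 1 l, add_comm 1 l, haj] at hle
      rw [h1, Finset.sum_range_succ, add_comm 1 l, ht] at e
      have e₃ : (fun i => thueMorseBool (1 + (l + 1 + i))) =
          fun i => thueMorseBool (l + 1 + 1 + i) := by
        funext i; ring_nf
      rw [e₃] at e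
      have hmono : ∑ i ∈ Finset.range l, ((thueMorseBool (1 + i)).toNat : ℝ) / Q ^ (i + 1) ≤
          ∑ i ∈ Finset.range l, ((thueMorseBool (1 + i)).toNat : ℝ) / q ^ (i + 1) := by
        gcongr
      have hlast : digitSum Q (fun i => thueMorseBool (l + 1 + 1 + i)) / Q ^ (l + 1) ≤
          1 / q ^ (l + 1) := by
        gcongr
      simp only [Bool.toNat_true, Bool.toNat_false, Nat.cast_one, Nat.cast_zero, zero_div] at e hle
      linarith

theorem EventuallyPeriodic.of_shift {a : ℕ → Bool} (M : ℕ)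
    (h : EventuallyPeriodic fun i => a (M + i)) : EventuallyPeriodic a := by
  obtain ⟨N, p, hp, h⟩ := h
  refine ⟨M + N, p, hp, fun n hn => ?_⟩
  obtain ⟨i, rfl⟩ := Nat.exists_eq_add_of_le (Nat.le_of_add_right_le hn)
  rw [add_assoc]
  exact h i (by omega)

/-- An expansion that is isolated among the expansions of its value is eventually periodic. -/
theorem eventuallyPeriodic_of_isolated {q Q : ℝ} (hq : 1 < q) (hqQ : q < Q) (hQ2 : Q < 2)
    (h1 : digitSum Q (fun i => thueMorseBool (1 + i)) = 1) {a : ℕ → Bool} {M : ℕ}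
    (ha : ∀ c, digitSum q c = digitSum q a → (∀ i < M, c i = a i) → c = a) :
    EventuallyPeriodic a := by
  have hq1 : 0 < q - 1 := by linarith
  have hone : 1 ≤ 1 / (q - 1) := by rw [le_div_iff₀ hq1]; linarith
  have hfirst (n : ℕ) (hn : M ≤ n) (b : Bool) (y : ℝ) (hy : y ∈ Set.Icc 0 (1 / (q - 1)))
      (hb : b.toNat + y = (a n).toNat + digitSum q (fun i => a (n + 1 + i))) : b = a n := by
    obtain ⟨c, rfl⟩ := exists_digitSum_eq hq (by linarith) hy
    let d : ℕ → Bool := fun i => if i < n then a i else if i = n then b else c (i - (n + 1))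
    have hdlt (i : ℕ) (hi : i < n) : d i = a i := by simp [d, hi]
    have hdn : d n = b := by simp [d]
    have hdtail : (fun i => d (n + (1 + i))) = c := by
      funext i
      have h₁ : ¬ n + (1 + i) < n := by omega
      have h₂ : n + (1 + i) - (n + 1) = i := by omega
      simp [d, h₂]
    rw [← hdn]
    refine congrFun (ha d ?_ fun i hi => hdlt i (by omega)) n
    rw [digitSum_eq_sum_add hq d n, digitSum_eq_sum_add hq a n,
      digitSum_succ hq (fun i => d (n + i)), digitSum_succ hq (fun i => a (n + i)), hdtail]
    simp only [add_zero, hdn, hb, ← add_assoc]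
    congr 1
    exact Finset.sum_congr rfl fun i hi => by rw [hdlt i (Finset.mem_range.1 hi)]
  obtain ⟨N, hN⟩ := exists_one_lt_sum_thueMorseBool hq hqQ h1
  refine .of_shift M (eventuallyPeriodic_of_below (N + 1) _ fun n => ?_)
  suffices ∃ j < N + 1, BelowThueMorseAt (fun i => a (M + i)) n j by
    obtain ⟨j, hj, h⟩ := this
    exact ⟨j, hj.trans Nat.lt_two_pow_self, h⟩
  cases hn : a (M + n) with
  | false =>
    refine exists_belowThueMorseAt hq hqQ h1 hN hn ?_
    by_contra! hge
    simp only [← add_assoc] at hge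
    have := hfirst (M + n) (by omega) true (digitSum q (fun i => a (M + n + 1 + i)) - 1)
      ⟨by linarith, by linarith [digitSum_le hq (fun i => a (M + n + 1 + i))]⟩ (by simp [hn])
    simp [hn] at this
  | true =>
    suffices ∃ j < N + 1, BelowThueMorseAt (fun i => !a (M + i)) n j by
      obtain ⟨j, hj, h⟩ := this
      exact ⟨j, hj, belowThueMorseAt_not.1 h⟩
    refine exists_belowThueMorseAt hq hqQ h1 hN (by simp [hn]) ?_
    by_contra! hge
    rw [digitSum_not hq fun i => a (M + (n + 1 + i))] at hge
    simp only [← add_assoc] at hge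
    have := hfirst (M + n) (by omega) false (digitSum q (fun i => a (M + n + 1 + i)) + 1)
      ⟨by linarith [digitSum_nonneg hq (fun i => a (M + n + 1 + i))], by linarith⟩
      (by simp [hn, add_comm])
    simp [hn] at this

theorem apply_add_mul_of_periodic_from {a : ℕ → Bool} {N p : ℕ} (h : ∀ n ≥ N, a (n + p) = a n)
    (k : ℕ) : ∀ n ≥ N, a (n + p * k) = a n := by
  induction k with
  | zero => simp
  | succ k ih =>
    intro n hn
    rw [mul_add, mul_one, ← add_assoc, h _ (by omega), ih n hn]

/-- A base in which two distinct eventually periodic sequences have the same value is algebraic. -/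
theorem isAlgebraic_of_eventuallyPeriodic {q : ℝ} (hq : 1 < q) {a b : ℕ → Bool}
    (ha : EventuallyPeriodic a) (hb : EventuallyPeriodic b) (hab : a ≠ b)
    (hval : digitSum q a = digitSum q b) : IsAlgebraic ℚ q := by
  obtain ⟨N₁, p₁, hp₁, h₁⟩ := ha
  obtain ⟨N₂, p₂, hp₂, h₂⟩ := hb
  have hne : ∃ n, a n ≠ b n := Function.ne_iff.1 hab
  classical
  have hm := Nat.find_spec hne
  have hmin (i : ℕ) (hi : i < Nat.find hne) : a i = b i := not_not.1 (Nat.find_min hne hi)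
  generalize Nat.find hne = m at hm hmin
  obtain ⟨N, hN₁, hN₂, hmN⟩ : ∃ N, N₁ ≤ N ∧ N₂ ≤ N ∧ m < N :=
    ⟨N₁ + N₂ + m + 1, by omega, by omega, by omega⟩
  obtain ⟨p, hp, hpa, hpb⟩ : ∃ p, 0 < p ∧ (∀ i, a (N + p + i) = a (N + i)) ∧
      ∀ i, b (N + p + i) = b (N + i) := by
    refine ⟨p₁ * p₂, Nat.mul_pos hp₁ hp₂, fun i => ?_, fun i => ?_⟩
    · rw [add_right_comm]
      exact apply_add_mul_of_periodic_from h₁ _ _ (by omega)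
    · rw [add_right_comm, mul_comm]
      exact apply_add_mul_of_periodic_from h₂ _ _ (by omega)
  let d : ℕ → ℚ := fun n => (a n).toNat - (b n).toNat
  have hd (i : ℕ) (hi : i < m) : d i = 0 := by simp [d, hmin i hi]
  have hdm : d m ≠ 0 := by
    revert hm
    simp only [d]
    cases a m <;> cases b m <;> simp
  let S : ℕ → Polynomial ℚ := fun K =>
    ∑ i ∈ Finset.range K, Polynomial.C (d i) * Polynomial.X ^ (i + 1)
  have hS (K n : ℕ) (hK : n < K) : (S K).coeff (n + 1) = d n := by
    simp [S, Polynomial.coeff_X_pow, hK]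
  have hS0 (K n : ℕ) (hn : n < m + 1) : (S K).coeff n = 0 := by
    simp only [S, Polynomial.finsetSum_coeff, Polynomial.coeff_C_mul_X_pow]
    refine Finset.sum_eq_zero fun i _ => ?_
    split_ifs with h
    · exact hd i (by omega)
    · rfl
  have hSeval (K : ℕ) : Polynomial.aeval q⁻¹ (S K) +
      (digitSum q (fun i => a (K + i)) - digitSum q (fun i => b (K + i))) * q⁻¹ ^ K = 0 := by
    have e₁ := digitSum_eq_sum_add hq a K
    have e₂ := digitSum_eq_sum_add hq b K
    have e₃ : Polynomial.aeval q⁻¹ (S K) =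
        ∑ i ∈ Finset.range K, ((a i).toNat : ℝ) / q ^ (i + 1) -
          ∑ i ∈ Finset.range K, ((b i).toNat : ℝ) / q ^ (i + 1) := by
      rw [← Finset.sum_sub_distrib, map_sum]
      refine Finset.sum_congr rfl fun i _ => ?_
      simp [d, div_eq_mul_inv, sub_mul]
    rw [e₃, inv_pow, ← div_eq_mul_inv, sub_div]
    linarith
  have hinv : IsAlgebraic ℚ q⁻¹ := by
    refine ⟨S (N + p) - Polynomial.X ^ p * S N, fun h => hdm ?_, ?_⟩
    · have := congrArg (fun P => Polynomial.coeff P (m + 1)) h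
      simp only [Polynomial.coeff_sub, Polynomial.coeff_X_pow_mul', Polynomial.coeff_zero] at this
      rw [hS _ _ (by omega)] at this
      split_ifs at this with h'
      · rwa [hS0 _ _ (by omega), sub_zero] at this
      · rwa [sub_zero] at this
    · have e₁ := hSeval N
      have e₂ := hSeval (N + p)
      simp only [hpa, hpb] at e₂
      rw [map_sub, map_mul, map_pow, Polynomial.aeval_X]
      rw [pow_add] at e₂
      linear_combination e₂ - q⁻¹ ^ p * e₁
  simpa using hinv.inv

theorem exists_eq_of_not_accPt {C : Set (ℕ → Bool)} {a : ℕ → Bool}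
    (h : ¬ AccPt a (Filter.principal C)) : ∃ M, ∀ c ∈ C, (∀ i < M, c i = a i) → c = a := by
  rw [accPt_iff_nhds] at h
  push Not at h
  obtain ⟨U, hU, h⟩ := h
  obtain ⟨_, ⟨b, M, rfl⟩, ha, hsub⟩ :=
    (PiNat.isTopologicalBasis_cylinders fun _ : ℕ => Bool).mem_nhds_iff.1 hU
  refine ⟨M, fun c hc hca => h c ⟨hsub ?_, hc⟩⟩
  rw [PiNat.mem_cylinder_iff] at ha ⊢
  intro i hi
  rw [hca i hi, ha i hi]

theorem mk_eq_continuum_of_preperfect {C : Set (ℕ → Bool)} (hC : IsClosed C)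
    (hacc : ∀ a ∈ C, AccPt a (Filter.principal C)) (hne : C.Nonempty) :
    Cardinal.mk C = Cardinal.continuum := by
  let _ := TopologicalSpace.upgradeIsCompletelyMetrizable (ℕ → Bool)
  obtain ⟨f, hf, -, hinj⟩ := Perfect.exists_nat_bool_injection ⟨hC, hacc⟩ hne
  have hcard : Cardinal.mk (ℕ → Bool) = Cardinal.continuum := by simp
  refine le_antisymm ((Cardinal.mk_set_le C).trans hcard.le) ?_
  rw [← hcard, ← Cardinal.mk_range_eq f hinj]
  exact Cardinal.mk_le_mk_of_subset hf

/-- A fibre of `digitSum q` is either a subsingleton, or of the cardinality of the continuum. -/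
theorem subsingleton_or_mk_eq_continuum {q Q : ℝ} (hq : 1 < q) (hqQ : q < Q) (hQ2 : Q < 2)
    (h1 : digitSum Q (fun i => thueMorseBool (1 + i)) = 1) (hqt : Transcendental ℚ q) (x : ℝ) :
    {a | digitSum q a = x}.Subsingleton ∨
      Cardinal.mk {a | digitSum q a = x} = Cardinal.continuum := by
  refine or_iff_not_imp_left.2 fun hns => ?_
  have hcard : Cardinal.mk (ℕ → Bool) = Cardinal.continuum := by simp
  rw [Set.not_subsingleton_iff] at hns
  obtain ⟨a, ha, b, hb, hab⟩ := hns
  obtain ⟨n, hn⟩ := Function.ne_iff.1 hab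
  have piece (u : ℕ → Bool) (hu : digitSum q u = x) :
      (∃ c, digitSum q c = x ∧ c n = u n ∧ EventuallyPeriodic c) ∨
        Cardinal.mk {a | digitSum q a = x} = Cardinal.continuum := by
    let C : Set (ℕ → Bool) := {c | digitSum q c = x ∧ c n = u n}
    have hC : IsClosed C := (isClosed_eq (continuous_digitSum hq) continuous_const).inter
      (isClosed_eq (continuous_apply n) continuous_const)
    by_cases hacc : ∀ c ∈ C, AccPt c (Filter.principal C)
    · right
      refine le_antisymm ((Cardinal.mk_set_le _).trans hcard.le) ?_
      rw [← mk_eq_continuum_of_preperfect hC hacc ⟨u, hu, rfl⟩]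
      exact Cardinal.mk_le_mk_of_subset fun c hc => hc.1
    · left
      push Not at hacc
      obtain ⟨c, ⟨hcx, hcn⟩, hc⟩ := hacc
      obtain ⟨M, hM⟩ := exists_eq_of_not_accPt hc
      refine ⟨c, hcx, hcn, eventuallyPeriodic_of_isolated (M := M + n + 1) hq hqQ hQ2 h1 ?_⟩
      intro d hd hdc
      exact hM d ⟨hd.trans hcx, (hdc n (by omega)).trans hcn⟩ fun i hi => hdc i (by omega)
  rcases piece a ha with ⟨c, hc, hcn, hcp⟩ | h
  · rcases piece b hb with ⟨d, hd, hdn, hdp⟩ | h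
    · refine absurd (isAlgebraic_of_eventuallyPeriodic hq hcp hdp ?_ (hc.trans hd.symm)) hqt
      rintro rfl
      exact hn (hcn.symm.trans hdn)
    · exact h
  · exact h

theorem mk_expansionsOf (q x : ℝ) :
    Cardinal.mk (expansionsOf q x) = Cardinal.mk {a | digitSum q a = x} := by
  refine Cardinal.mk_congr
    { toFun := fun a => ⟨fun n => decide (a.1 n = 1), ?_⟩
      invFun := fun a => ⟨fun n => (a.1 n).toNat, fun n => Bool.toNat_le _, a.2.symm⟩
      left_inv := fun a => Subtype.ext (funext fun n => ?_)
      right_inv := fun a => Subtype.ext (funext fun n => ?_) }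
  · exact (tsum_congr fun n => by rw [toNat_decide_eq_one (a.2.1 n)]).trans a.2.2.symm
  · exact toNat_decide_eq_one (a.2.1 n)
  · change decide ((a.1 n).toNat = 1) = a.1 n
    generalize a.1 n = b
    cases b <;> rfl

theorem stmt0 (qKL : ℝ) (hqKL : qKL ∈ Set.Ioo (1:ℝ) 2)
    (hqKLeq : ∑' n : ℕ, (thueMorse (n + 1) : ℝ) / qKL ^ (n + 1) = 1)
    (q : ℝ) (hq : q ∈ Set.Ioo ((1 + Real.sqrt 5) / 2) qKL)
    (hqt : Transcendental ℚ q) :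
    ∀ x ∈ Set.Icc (0:ℝ) (1 / (q - 1)),
      Cardinal.mk (expansionsOf q x) = 1 ∨
        Cardinal.mk (expansionsOf q x) = Cardinal.continuum := by
  intro x hx
  have hq1 : 1 < q := Real.one_lt_goldenRatio.trans hq.1
  have h1 : digitSum qKL (fun i => thueMorseBool (1 + i)) = 1 := by
    simpa only [digitSum, toNat_thueMorseBool, add_comm 1] using hqKLeq
  rw [mk_expansionsOf]
  refine (subsingleton_or_mk_eq_continuum hq1 hq.2 hqKL.2 h1 hqt x).imp_left fun h => ?_
  obtain ⟨a, ha⟩ := exists_digitSum_eq hq1 (hq.2.trans hqKL.2).le hx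
  exact le_antisymm (Cardinal.mk_le_one_iff_set_subsingleton.2 h)
    (Cardinal.one_le_iff_ne_zero.2 (Cardinal.mk_ne_zero_iff.2 ⟨⟨a, ha⟩⟩))
end
end

section
/- The smallest element of B_2 is q_2, the root in (1,2) of x⁴ = 2x² + x + 1 (numerically q_2 ≈ 1.71064). Moreover B_2 ∩ (G, q_f) = {q_2}, where q_f is the root in (1,2) of x³ = 2x² − x + 1. -/
noncomputable section

/-! ### Basic facts on expansions -/

theorem expansion_summable {q : ℝ} (hq : 1 < q) {a : ℕ → ℕ} (ha : ∀ n, a n ≤ 1) :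
    Summable fun n : ℕ => (a n : ℝ) / q ^ (n + 1) := by
  have h0 : 0 < q := by linarith
  have hs : Summable fun n : ℕ => (1 / q) ^ n * (1 / q) :=
    (summable_geometric_of_lt_one (by positivity) (by rw [div_lt_one h0]; exact hq)).mul_right _
  refine Summable.of_nonneg_of_le (fun n => by positivity) (fun n => ?_) hs
  have h1 : (a n : ℝ) ≤ 1 := by exact_mod_cast ha n
  rw [← pow_succ, one_div_pow]
  gcongr

/-- A digit sequence driving a bounded orbit of `t ↦ q t - d` is an expansion of the starting
point of the orbit. -/
theorem isExpansion_of_bounded_orbit {q C : ℝ} (hq : 1 < q) {a : ℕ → ℕ} (ha : ∀ n, a n ≤ 1)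
    (t : ℕ → ℝ) (ht : ∀ n, |t n| ≤ C) (hrec : ∀ n, t (n + 1) = q * t n - a n) :
    IsExpansion q (t 0) a := by
  have h0 : 0 < q := by linarith
  refine ⟨ha, ?_⟩
  have key : ∀ n, ∑ i ∈ Finset.range n, (a i : ℝ) / q ^ (i + 1) = t 0 - t n / q ^ n := by
    intro n
    induction n with
    | zero => simp
    | succ n ih =>
      rw [Finset.sum_range_succ, ih, hrec]
      field_simp
      ring
  have hlim : Filter.Tendsto (fun n => t n / q ^ n) Filter.atTop (nhds 0) := by
    have h2 : Filter.Tendsto (fun n : ℕ => C * (1 / q) ^ n) Filter.atTop (nhds 0) := by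
      simpa using (tendsto_pow_atTop_nhds_zero_of_lt_one (r := 1 / q) (by positivity)
        (by rw [div_lt_one h0]; exact hq)).const_mul C
    refine squeeze_zero_norm (fun n => ?_) h2
    rw [Real.norm_eq_abs, abs_div, abs_of_pos (pow_pos h0 n), one_div_pow, mul_one_div]
    gcongr
    exact ht n
  have hsum := (expansion_summable hq ha).hasSum.tendsto_sum_nat
  refine tendsto_nhds_unique ?_ hsum
  simp only [key]
  simpa using hlim.const_sub (t 0)

theorem isExpansion_iff_tail {q x : ℝ} (hq : 1 < q) {a : ℕ → ℕ} :
    IsExpansion q x a ↔ a 0 ≤ 1 ∧ IsExpansion q (q * x - a 0) (fun n => a (n + 1)) := by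
  have h0 : 0 < q := by linarith
  have key : (∀ n, a n ≤ 1) → ∑' n : ℕ, (a n : ℝ) / q ^ (n + 1) =
      (a 0 + ∑' n : ℕ, (a (n + 1) : ℝ) / q ^ (n + 1)) / q := by
    intro ha
    rw [(expansion_summable hq ha).tsum_eq_zero_add, add_div, ← tsum_div_const]
    simp only [zero_add, pow_zero, one_mul, pow_succ, div_div]
  constructor
  · rintro ⟨ha, hx⟩
    refine ⟨ha 0, fun n => ha _, ?_⟩
    rw [hx, key ha]
    field_simp
    ring
  · rintro ⟨h, ha, hx⟩
    have ha' : ∀ n, a n ≤ 1 := fun n => by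
      cases n with
      | zero => exact h
      | succ n => exact ha n
    refine ⟨ha', ?_⟩
    rw [key ha', ← hx]
    field_simp
    ring

theorem IsExpansion.mem_Icc {q x : ℝ} (hq : 1 < q) {a : ℕ → ℕ} (h : IsExpansion q x a) :
    x ∈ Set.Icc 0 (1 / (q - 1)) := by
  have h0 : 0 < q := by linarith
  have h1 : 0 < q - 1 := by linarith
  have hone : IsExpansion q (1 / (q - 1)) (fun _ => 1) := by
    refine isExpansion_of_bounded_orbit (C := 1 / (q - 1)) hq (fun _ => le_rfl)
      (fun _ => 1 / (q - 1)) (fun _ => (abs_of_pos (by positivity)).le) (fun _ => ?_)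
    field_simp
    push_cast
    ring
  obtain ⟨ha, rfl⟩ := h
  refine ⟨tsum_nonneg fun n => by positivity, ?_⟩
  rw [hone.2]
  refine (expansion_summable hq ha).tsum_le_tsum (fun n => ?_) (expansion_summable hq hone.1)
  have : (a n : ℝ) ≤ 1 := by exact_mod_cast ha n
  push_cast
  gcongr

/-- The digit sequence `d, c 0, c 1, …`. -/
def consDigit (d : ℕ) (c : ℕ → ℕ) : ℕ → ℕ
  | 0 => d
  | n + 1 => c n

theorem isExpansion_cons {q x : ℝ} (hq : 1 < q) {d : ℕ} (hd : d ≤ 1) {c : ℕ → ℕ}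
    (h : IsExpansion q (q * x - d) c) : IsExpansion q x (consDigit d c) := by
  rw [isExpansion_iff_tail hq]
  exact ⟨hd, h⟩

theorem exists_isExpansion {q x : ℝ} (hq : 1 < q) (hq2 : q ≤ 2)
    (hx : x ∈ Set.Icc 0 (1 / (q - 1))) : ∃ a, IsExpansion q x a := by
  have h1 : 0 < q - 1 := by linarith
  let d : ℝ → ℕ := fun y => if q * y < 1 then 0 else 1
  let T : ℝ → ℝ := fun y => q * y - d y
  have hT : ∀ y ∈ Set.Icc 0 (1 / (q - 1)), T y ∈ Set.Icc 0 (1 / (q - 1)) := by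
    rintro y ⟨hy0, hy1⟩
    have h2 : 1 ≤ 1 / (q - 1) := by rw [le_div_iff₀ h1]; linarith
    have h3 : q * (1 / (q - 1)) = 1 / (q - 1) + 1 := by field_simp; ring
    have h4 : q * y ≤ q * (1 / (q - 1)) := by gcongr
    have h5 : 0 ≤ q * y := by positivity
    by_cases h : q * y < 1
    · simp only [T, d, h, if_true, Set.mem_Icc, Nat.cast_zero]
      constructor <;> linarith
    · simp only [T, d, h, if_false, Set.mem_Icc, Nat.cast_one]
      constructor <;> linarith
  have hit : ∀ n, T^[n] x ∈ Set.Icc 0 (1 / (q - 1)) := by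
    intro n
    induction n with
    | zero => exact hx
    | succ n ih => rw [Function.iterate_succ_apply']; exact hT _ ih
  refine ⟨fun n => d (T^[n] x), isExpansion_of_bounded_orbit (C := 1 / (q - 1)) hq (fun n => ?_)
    (fun n => T^[n] x) (fun n => ?_) (fun n => ?_)⟩
  · simp only [d]; split_ifs <;> simp
  · rw [abs_of_nonneg (hit n).1]; exact (hit n).2
  · simp only [Function.iterate_succ_apply']; rfl

/-! ### Unique expansions -/

/-- `a` is the only expansion of `x` in base `q`. -/
def IsOnlyExpansion (q x : ℝ) (a : ℕ → ℕ) : Prop :=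
  IsExpansion q x a ∧ ∀ c, IsExpansion q x c → c = a

theorem IsOnlyExpansion.tail {q x : ℝ} (hq : 1 < q) {a : ℕ → ℕ} (h : IsOnlyExpansion q x a) :
    IsOnlyExpansion q (q * x - a 0) (fun n => a (n + 1)) := by
  refine ⟨((isExpansion_iff_tail hq).1 h.1).2, fun c hc => ?_⟩
  have h2 := h.2 _ (isExpansion_cons hq (h.1.1 0) hc)
  rw [← h2]
  rfl

theorem IsOnlyExpansion.shift {q x : ℝ} (hq : 1 < q) {a : ℕ → ℕ} (h : IsOnlyExpansion q x a)
    (n : ℕ) : ∃ y, IsOnlyExpansion q y (fun k => a (k + n)) := by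
  induction n with
  | zero => exact ⟨x, h⟩
  | succ n ih =>
    obtain ⟨y, hy⟩ := ih
    have h := hy.tail hq
    simp only [add_right_comm _ 1 n] at h
    exact ⟨_, h⟩

theorem IsOnlyExpansion.lt_one {q x : ℝ} (hq : 1 < q) (hq2 : q ≤ 2) {a : ℕ → ℕ}
    (h : IsOnlyExpansion q x a) (h0 : a 0 = 0) : q * x < 1 := by
  by_contra! hlt
  have h2 := ((h.tail hq).1.mem_Icc hq).2
  rw [h0, Nat.cast_zero] at h2
  obtain ⟨c, hc⟩ := exists_isExpansion (x := q * x - (1 : ℕ)) hq hq2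
    ⟨by push_cast; linarith, by push_cast; linarith⟩
  have h3 := congrFun (h.2 _ (isExpansion_cons hq le_rfl hc)) 0
  rw [h0] at h3
  exact one_ne_zero h3

theorem IsOnlyExpansion.gt_of_one {q x : ℝ} (hq : 1 < q) (hq2 : q ≤ 2) {a : ℕ → ℕ}
    (h : IsOnlyExpansion q x a) (h1 : a 0 = 1) : 1 / (q - 1) < q * x := by
  by_contra! hlt
  have h2 := (h.1.mem_Icc hq).1
  obtain ⟨c, hc⟩ := exists_isExpansion (x := q * x - (0 : ℕ)) hq hq2
    ⟨by push_cast; nlinarith, by push_cast; linarith⟩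
  have h3 := congrFun (h.2 _ (isExpansion_cons hq zero_le_one hc)) 0
  rw [h1] at h3
  exact zero_ne_one h3

theorem isOnlyExpansion_cons_zero {q x : ℝ} (hq : 1 < q) {a : ℕ → ℕ}
    (h : IsOnlyExpansion q (q * x) a) (hx : q * x < 1) :
    IsOnlyExpansion q x (consDigit 0 a) := by
  refine ⟨isExpansion_cons hq zero_le_one (by simpa using h.1), fun c hc => ?_⟩
  obtain ⟨h1, h2⟩ := (isExpansion_iff_tail hq).1 hc
  have h3 : c 0 = 0 := by
    by_contra hne
    have h4 : c 0 = 1 := by omega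
    have := (h2.mem_Icc hq).1
    rw [h4] at this
    push_cast at this
    linarith
  rw [h3, Nat.cast_zero, sub_zero] at h2
  funext n
  cases n with
  | zero => exact h3
  | succ n => exact congrFun (h.2 _ h2) n

theorem isOnlyExpansion_cons_one {q x : ℝ} (hq : 1 < q) {a : ℕ → ℕ}
    (h : IsOnlyExpansion q (q * x - 1) a) (hx : 1 / (q - 1) < q * x) :
    IsOnlyExpansion q x (consDigit 1 a) := by
  refine ⟨isExpansion_cons hq le_rfl (by simpa using h.1), fun c hc => ?_⟩
  obtain ⟨h1, h2⟩ := (isExpansion_iff_tail hq).1 hc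
  have h3 : c 0 = 1 := by
    by_contra hne
    have h4 : c 0 = 0 := by omega
    have := (h2.mem_Icc hq).2
    rw [h4] at this
    push_cast at this
    linarith
  rw [h3, Nat.cast_one] at h2
  funext n
  cases n with
  | zero => exact h3
  | succ n => exact congrFun (h.2 _ h2) n

/-! ### Alternating sequences -/

theorem isExpansion_alternating_zero {q : ℝ} (hq : 1 < q) :
    IsExpansion q (1 / (q ^ 2 - 1)) (fun n => n % 2) := by
  have h1 : 0 < q ^ 2 - 1 := by nlinarith
  have h := isExpansion_of_bounded_orbit (C := q / (q ^ 2 - 1)) hq (a := fun n => n % 2)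
    (fun n => by show n % 2 ≤ 1; omega)
    (fun n => if n % 2 = 0 then 1 / (q ^ 2 - 1) else q / (q ^ 2 - 1)) (fun n => ?_) (fun n => ?_)
  · simpa using h
  · split_ifs
    · rw [abs_of_pos (by positivity)]; gcongr
    · rw [abs_of_pos (by positivity)]
  · rcases Nat.mod_two_eq_zero_or_one n with h | h
    · have h' : (n + 1) % 2 = 1 := by omega
      simp only [h, h', one_ne_zero, if_true, if_false]
      push_cast
      ring
    · have h' : (n + 1) % 2 = 0 := by omega
      simp only [h, h', one_ne_zero, if_true, if_false]
      push_cast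
      field_simp
      ring

theorem isExpansion_alternating_one {q : ℝ} (hq : 1 < q) :
    IsExpansion q (q / (q ^ 2 - 1)) (fun n => (n + 1) % 2) := by
  have h := ((isExpansion_iff_tail hq).1 (isExpansion_alternating_zero hq)).2
  rw [Nat.zero_mod, Nat.cast_zero, sub_zero, mul_one_div] at h
  exact h

theorem isOnlyExpansion_alternating {q : ℝ} (hq : 1 < q) (hG : 0 < q ^ 2 - q - 1) :
    IsOnlyExpansion q (q / (q ^ 2 - 1)) (fun n => (n + 1) % 2) := by
  have h1 : 0 < q ^ 2 - 1 := by nlinarith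
  have h2 : 0 < q - 1 := by linarith
  refine ⟨isExpansion_alternating_one hq, fun c hc => ?_⟩
  have hstep : ∀ b : ℕ → ℕ, IsExpansion q (q / (q ^ 2 - 1)) b →
      b 0 = 1 ∧ b 1 = 0 ∧ IsExpansion q (q / (q ^ 2 - 1)) (fun n => b (n + 2)) := by
    intro b hb
    obtain ⟨h3, h4⟩ := (isExpansion_iff_tail hq).1 hb
    have hb0 : b 0 = 1 := by
      by_contra hne
      have h0 : b 0 = 0 := by omega
      have := (h4.mem_Icc hq).2
      rw [h0, Nat.cast_zero, sub_zero, mul_div, div_le_div_iff₀ h1 h2] at this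
      nlinarith
    have he : q * (q / (q ^ 2 - 1)) - (b 0 : ℕ) = 1 / (q ^ 2 - 1) := by
      rw [hb0]; push_cast; field_simp; ring
    rw [he] at h4
    obtain ⟨h5, h6⟩ := (isExpansion_iff_tail hq).1 h4
    simp only [zero_add] at h5 h6
    have hb1 : b 1 = 0 := by
      by_contra hne
      have h0 : b 1 = 1 := by omega
      have := (h6.mem_Icc hq).1
      rw [h0, Nat.cast_one, mul_one_div, sub_nonneg, le_div_iff₀ h1] at this
      nlinarith
    refine ⟨hb0, hb1, ?_⟩
    rw [hb1, Nat.cast_zero, sub_zero, mul_one_div] at h6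
    exact h6
  have hall : ∀ k, IsExpansion q (q / (q ^ 2 - 1)) (fun n => c (n + 2 * k)) := by
    intro k
    induction k with
    | zero => exact hc
    | succ k ih =>
      have := (hstep _ ih).2.2
      simpa only [mul_add, mul_one, add_assoc, add_comm, add_left_comm] using this
  funext n
  have h7 := hstep _ (hall (n / 2))
  simp only [zero_add] at h7
  rcases Nat.mod_two_eq_zero_or_one n with h | h
  · have h8 : 2 * (n / 2) = n := by omega
    rw [h8] at h7
    rw [h7.1]; omega
  · have h8 : 1 + 2 * (n / 2) = n := by omega
    rw [h8] at h7
    rw [h7.2.1]; omega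

/-! ### Unique expansions in small bases -/

section SmallBase

variable {q : ℝ}

theorem IsOnlyExpansion.not_zero_one_one (hq : 1 < q) (hq2 : q ≤ 2)
    (hf : q ^ 3 - 2 * q ^ 2 + q - 1 ≤ 0) {x : ℝ} {a : ℕ → ℕ} (h : IsOnlyExpansion q x a)
    (h0 : a 0 = 0) (h1 : a 1 = 1) : a 2 = 0 := by
  by_contra hne
  have h2 : a 2 = 1 := by have := h.1.1 2; omega
  have hlt := h.lt_one hq hq2 h0
  have hgt := (h.tail hq).tail hq |>.gt_of_one hq hq2 h2
  simp only [zero_add, h0, h1, Nat.cast_zero, Nat.cast_one, sub_zero] at hgt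
  rw [div_lt_iff₀ (by linarith)] at hgt
  nlinarith [mul_pos (mul_pos (sub_pos.2 hq) (show 0 < q by linarith))
    (mul_pos (sub_pos.2 hlt) (show 0 < q by linarith))]

theorem IsOnlyExpansion.not_one_zero_zero (hq : 1 < q) (hq2 : q ≤ 2)
    (hf : q ^ 3 - 2 * q ^ 2 + q - 1 ≤ 0) {x : ℝ} {a : ℕ → ℕ} (h : IsOnlyExpansion q x a)
    (h0 : a 0 = 1) (h1 : a 1 = 0) : a 2 = 1 := by
  by_contra hne
  have h2 : a 2 = 0 := by have := h.1.1 2; omega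
  have hgt := h.gt_of_one hq hq2 h0
  have hlt := (h.tail hq).tail hq |>.lt_one hq hq2 h2
  simp only [zero_add, h0, h1, Nat.cast_zero, Nat.cast_one, sub_zero] at hlt
  rw [div_lt_iff₀ (by linarith)] at hgt
  nlinarith [mul_pos (sub_pos.2 hgt) (show 0 < q ^ 2 by positivity)]

theorem IsOnlyExpansion.ne_succ (hq : 1 < q) (hq2 : q ≤ 2)
    (hf : q ^ 3 - 2 * q ^ 2 + q - 1 ≤ 0) {x : ℝ} {a : ℕ → ℕ} (h : IsOnlyExpansion q x a)
    (h0 : a 0 ≠ a 1) (n : ℕ) : a n ≠ a (n + 1) := by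
  induction n with
  | zero => exact h0
  | succ n ih =>
    obtain ⟨y, hy⟩ := h.shift hq n
    have h1 := hy.not_zero_one_one hq hq2 hf
    have h2 := hy.not_one_zero_zero hq hq2 hf
    simp only [zero_add, add_comm 1 n, add_comm 2 n] at h1 h2
    have h3 := h.1.1 n
    have h4 := h.1.1 (n + 1)
    show a (n + 1) ≠ a (n + 2)
    by_cases h5 : a n = 0
    · have := h1 h5 (by omega); omega
    · have := h2 (by omega) (by omega); omega

theorem alternating_eq {a : ℕ → ℕ} (ha : ∀ n, a n ≤ 1) (h : ∀ n, a n ≠ a (n + 1)) (n : ℕ) :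
    a n = (n + a 0) % 2 := by
  induction n with
  | zero => have := ha 0; omega
  | succ n ih =>
    have h1 := ha (n + 1)
    have h2 := h n
    omega

theorem IsOnlyExpansion.value_of_ne (hq : 1 < q) (hq2 : q ≤ 2)
    (hf : q ^ 3 - 2 * q ^ 2 + q - 1 ≤ 0) (n : ℕ) : ∀ {x : ℝ} {a : ℕ → ℕ},
    IsOnlyExpansion q x a → a n ≠ a (n + 1) → ∃ m : ℕ,
      (a 0 = 0 → x = (1 / q) ^ m / (q ^ 2 - 1)) ∧
      (a 0 = 1 → x = 1 / (q - 1) - (1 / q) ^ m / (q ^ 2 - 1)) := by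
  have h0 : 0 < q := by linarith
  have h1 : 0 < q - 1 := by linarith
  have h2 : 0 < q ^ 2 - 1 := by nlinarith
  have hbase : ∀ {x : ℝ} {a : ℕ → ℕ}, IsOnlyExpansion q x a → a 0 ≠ a 1 → ∃ m : ℕ,
      (a 0 = 0 → x = (1 / q) ^ m / (q ^ 2 - 1)) ∧
      (a 0 = 1 → x = 1 / (q - 1) - (1 / q) ^ m / (q ^ 2 - 1)) := by
    intro x a h hne
    have halt := alternating_eq h.1.1 (h.ne_succ hq hq2 hf hne)
    refine ⟨0, fun ha => ?_, fun ha => ?_⟩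
    · have : a = fun n => n % 2 := funext fun n => by rw [halt n, ha, add_zero]
      rw [h.1.2, this, ← (isExpansion_alternating_zero hq).2, pow_zero]
    · have : a = fun n => (n + 1) % 2 := funext fun n => by rw [halt n, ha]
      rw [h.1.2, this, ← (isExpansion_alternating_one hq).2, pow_zero]
      field_simp
      ring
  induction n with
  | zero => exact hbase
  | succ n ih =>
    intro x a h hne
    by_cases h3 : a 0 = a 1
    · obtain ⟨m, hm0, hm1⟩ := ih (h.tail hq) hne
      simp only [zero_add] at hm0 hm1
      refine ⟨m + 1, fun ha => ?_, fun ha => ?_⟩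
      · have := hm0 (by omega)
        rw [ha, Nat.cast_zero, sub_zero] at this
        rw [pow_succ, mul_div_right_comm, ← this]
        field_simp
      · have := hm1 (by omega)
        rw [ha, Nat.cast_one] at this
        have h4 : (1 / q) ^ m / (q ^ 2 - 1) = 1 / (q - 1) - (q * x - 1) := by linarith
        rw [pow_succ, mul_div_right_comm, h4]
        field_simp
        ring
    · exact hbase h h3

/-- In a base below `q_f`, the points with a unique expansion are explicit. -/
theorem IsOnlyExpansion.value (hq : 1 < q) (hq2 : q ≤ 2)
    (hf : q ^ 3 - 2 * q ^ 2 + q - 1 ≤ 0) {x : ℝ} {a : ℕ → ℕ} (h : IsOnlyExpansion q x a) :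
    ∃ u : ℝ, (u = 0 ∨ ∃ m : ℕ, u = (1 / q) ^ m) ∧
      (x = u / (q ^ 2 - 1) ∨ x = 1 / (q - 1) - u / (q ^ 2 - 1)) := by
  by_cases hc : ∃ n, a n ≠ a (n + 1)
  · obtain ⟨n, hn⟩ := hc
    obtain ⟨m, h0, h1⟩ := h.value_of_ne hq hq2 hf n hn
    refine ⟨_, Or.inr ⟨m, rfl⟩, ?_⟩
    rcases Nat.le_one_iff_eq_zero_or_eq_one.1 (h.1.1 0) with h2 | h2
    · exact Or.inl (h0 h2)
    · exact Or.inr (h1 h2)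
  · push Not at hc
    have hconst : ∀ n, a n = a 0 := fun n => by
      induction n with
      | zero => rfl
      | succ n ih => rw [← hc n, ih]
    have ht := ((isExpansion_iff_tail hq).1 h.1).2
    have he : (fun n => a (n + 1)) = a := funext fun n => by rw [hconst, hconst n]
    rw [he] at ht
    have hfix : q * x - a 0 = x := ht.2.trans h.1.2.symm
    have h1 : q - 1 ≠ 0 := by linarith
    refine ⟨0, Or.inl rfl, ?_⟩
    rcases Nat.le_one_iff_eq_zero_or_eq_one.1 (h.1.1 0) with h2 | h2
    · left
      rw [h2, Nat.cast_zero] at hfix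
      rw [zero_div]
      have : x * (q - 1) = 0 := by linarith
      exact (mul_eq_zero.1 this).resolve_right h1
    · right
      rw [h2, Nat.cast_one] at hfix
      rw [zero_div, sub_zero, eq_div_iff h1]
      linarith

end SmallBase

/-! ### The equation for `q` -/

/-- If two points with a unique expansion differ by `1`, then `q` is a root of
`x⁴ = 2x² + x + 1`. -/
theorem quartic_eq_of_add_eq {q u v : ℝ} (hlo : 1.6 < q) (hG : 0 < q ^ 2 - q - 1)
    (hf : q ^ 3 - 2 * q ^ 2 + q - 1 < 0) (hhi : q < 1.756)
    (hu : u = 0 ∨ ∃ m : ℕ, u = (1 / q) ^ m) (hv : v = 0 ∨ ∃ m : ℕ, v = (1 / q) ^ m)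
    (h : u + v = 2 + q - q ^ 2) : q ^ 4 = 2 * q ^ 2 + q + 1 := by
  have h0 : 0 < q := by linarith
  set r := 1 / q with hr
  have hrpos : 0 < r := by positivity
  have hqr : q * r = 1 := by rw [hr]; field_simp
  have hr1 : r < 1 := by nlinarith
  have hlt1 : 2 + q - q ^ 2 < 1 := by linarith
  have hsingle : r < 2 + q - q ^ 2 := by
    rw [hr, div_lt_iff₀ h0]
    nlinarith
  have hdouble : 2 * r ^ 2 < 2 + q - q ^ 2 := by
    rw [hr, one_div_pow, mul_one_div, div_lt_iff₀ (by positivity)]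
    nlinarith [mul_pos (sub_pos.2 hlo) (sub_pos.2 hhi),
      mul_pos (mul_pos (sub_pos.2 hlo) (sub_pos.2 hhi)) (pow_pos h0 2),
      mul_pos (mul_pos (sub_pos.2 hlo) (sub_pos.2 hhi)) h0]
  have hfour : r + r ^ 4 < 2 + q - q ^ 2 := by
    have h1 : r + r ^ 4 = (q ^ 3 + 1) / q ^ 4 := by rw [hr]; field_simp
    rw [h1, div_lt_iff₀ (by positivity)]
    have h2 : 0 < q ^ 3 + q ^ 2 - q - 1 := by nlinarith [pow_pos h0 3, pow_pos h0 2]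
    nlinarith [mul_pos h2 (neg_pos.2 hf)]
  have hpos : ∀ {w : ℝ}, (w = 0 ∨ ∃ m : ℕ, w = r ^ m) → 0 ≤ w := by
    rintro w (rfl | ⟨m, rfl⟩)
    · exact le_rfl
    · positivity
  have hanti : ∀ {m n : ℕ}, m ≤ n → r ^ n ≤ r ^ m := fun hmn =>
    pow_le_pow_of_le_one hrpos.le hr1.le hmn
  have main : ∀ m n : ℕ, m ≤ n → r ^ m + r ^ n = 2 + q - q ^ 2 →
      q ^ 4 = 2 * q ^ 2 + q + 1 := by
    intro m n hmn he
    rcases Nat.lt_or_ge m 2 with hm | hm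
    · interval_cases m
      · rw [pow_zero] at he
        linarith [pow_pos hrpos n]
      · rw [pow_one] at he
        rcases Nat.lt_or_ge n 4 with hn | hn
        · have e1 : q * (r + r ^ n) = q * (2 + q - q ^ 2) := by rw [he]
          interval_cases n
          · have : q * (r + r ^ 1) = 2 := by linear_combination 2 * hqr
            nlinarith
          · have h3 : (q ^ 2 - 1) * (q ^ 2 - q - 1) = 0 := by
              have h4 : q ^ 2 * (r + r ^ 2) = q + 1 := by
                rw [hr]; field_simp
              rw [he] at h4
              linear_combination -h4
            have h5 : 0 < q ^ 2 - 1 := by nlinarith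
            exact absurd h3 (mul_pos h5 hG).ne'
          · have h3 : (q - 1) * (q ^ 4 - 2 * q ^ 2 - q - 1) = 0 := by
              have h4 : q ^ 3 * (r + r ^ 3) = q ^ 2 + 1 := by
                rw [hr]; field_simp
              rw [he] at h4
              linear_combination -h4
            have h5 : q - 1 ≠ 0 := by linarith
            linarith [(mul_eq_zero.1 h3).resolve_left h5]
        · linarith [hanti hn]
    · linarith [hanti hm, hanti (hm.trans hmn)]
  have single : ∀ m : ℕ, r ^ m ≠ 2 + q - q ^ 2 := by
    intro m he
    rcases Nat.eq_zero_or_pos m with rfl | hm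
    · rw [pow_zero] at he; linarith
    · have := hanti (show 1 ≤ m from hm)
      rw [pow_one] at this
      linarith
  rcases hu with rfl | ⟨m, rfl⟩ <;> rcases hv with rfl | ⟨n, rfl⟩
  · linarith
  · exact absurd (by linarith) (single n)
  · exact absurd (by linarith) (single m)
  · rcases le_total m n with hmn | hmn
    · exact main m n hmn h
    · exact main n m hmn (by rw [add_comm]; exact h)

theorem quartic_eq_of_unique_sub_eq_one {q x : ℝ} {a b : ℕ → ℕ} (hlo : 1.6 < q)
    (hG : 0 < q ^ 2 - q - 1) (hf : q ^ 3 - 2 * q ^ 2 + q - 1 < 0) (hhi : q < 1.756)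
    (ha : IsOnlyExpansion q x a) (hb : IsOnlyExpansion q (x - 1) b) :
    q ^ 4 = 2 * q ^ 2 + q + 1 := by
  have hq : 1 < q := by linarith
  have h1 : 0 < q - 1 := by linarith
  have h2 : 1 < q ^ 2 - 1 := by nlinarith
  have h3 : 0 < q ^ 2 - 1 := by linarith
  obtain ⟨u, hu, hxu⟩ := ha.value hq (by linarith) hf.le
  obtain ⟨v, hv, hyv⟩ := hb.value hq (by linarith) hf.le
  have hle : ∀ {w : ℝ}, (w = 0 ∨ ∃ m : ℕ, w = (1 / q) ^ m) → w / (q ^ 2 - 1) < 1 := by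
    intro w hw
    rw [div_lt_one h3]
    refine lt_of_le_of_lt ?_ h2
    rcases hw with rfl | ⟨m, rfl⟩
    · exact zero_le_one
    · exact pow_le_one₀ (by positivity) (by rw [div_le_one (by linarith)]; exact hq.le)
  have h4 := (hb.1.mem_Icc hq).1
  have h5 := (ha.1.mem_Icc hq).2
  have h6 := hle hu
  have h7 := hle hv
  rcases hxu with hxu | hxu
  · linarith
  rcases hyv with hyv | hyv
  · refine quartic_eq_of_add_eq hlo hG hf hhi hu hv ?_
    have h8 : u / (q ^ 2 - 1) + v / (q ^ 2 - 1) = 1 / (q - 1) - 1 := by linarith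
    field_simp at h8
    have h9 : (q - 1) * (u + v - (2 + q - q ^ 2)) = 0 := by linear_combination h8
    linarith [(mul_eq_zero.1 h9).resolve_left h1.ne']
  · linarith

/-! ### Points with exactly two expansions -/

theorem exists_branching {q : ℝ} (hq : 1 < q) (n : ℕ) : ∀ {x : ℝ} {a b : ℕ → ℕ},
    IsExpansion q x a → IsExpansion q x b → (∀ c, IsExpansion q x c → c = a ∨ c = b) →
    a n ≠ b n → ∃ y a' b', IsOnlyExpansion q y a' ∧ IsOnlyExpansion q (y - 1) b' := by
  have hbase : ∀ {x : ℝ} {a b : ℕ → ℕ},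
      IsExpansion q x a → IsExpansion q x b → (∀ c, IsExpansion q x c → c = a ∨ c = b) →
      a 0 = 0 → b 0 = 1 → ∃ y a' b', IsOnlyExpansion q y a' ∧ IsOnlyExpansion q (y - 1) b' := by
    intro x a b ha hb hab h0 h1
    have ha' := ((isExpansion_iff_tail hq).1 ha).2
    have hb' := ((isExpansion_iff_tail hq).1 hb).2
    rw [h0, Nat.cast_zero, sub_zero] at ha'
    rw [h1, Nat.cast_one] at hb'
    refine ⟨q * x, _, _, ⟨ha', fun c hc => ?_⟩, ⟨hb', fun c hc => ?_⟩⟩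
    · rcases hab _ (isExpansion_cons hq zero_le_one (c := c) (by simpa using hc)) with h | h
      · rw [← h]; rfl
      · have := congrFun h 0
        rw [h1] at this
        exact absurd this zero_ne_one
    · rcases hab _ (isExpansion_cons hq le_rfl (c := c) (by simpa using hc)) with h | h
      · have := congrFun h 0
        rw [h0] at this
        exact absurd this one_ne_zero
      · rw [← h]; rfl
  induction n with
  | zero =>
    intro x a b ha hb hab hne
    have h1 := ha.1 0
    have h2 := hb.1 0
    rcases Nat.le_one_iff_eq_zero_or_eq_one.1 h1 with h3 | h3
    · exact hbase ha hb hab h3 (by omega)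
    · exact hbase hb ha (fun c hc => (hab c hc).symm) (by omega) h3
  | succ n ih =>
    intro x a b ha hb hab hne
    have h1 := ha.1 0
    have h2 := hb.1 0
    by_cases he : a 0 = b 0
    · have ha' := ((isExpansion_iff_tail hq).1 ha).2
      have hb' := ((isExpansion_iff_tail hq).1 hb).2
      rw [← he] at hb'
      refine ih ha' hb' (fun c hc => ?_) hne
      rcases hab _ (isExpansion_cons hq h1 hc) with h | h
      · left; rw [← h]; rfl
      · right; rw [← h]; rfl
    · rcases Nat.le_one_iff_eq_zero_or_eq_one.1 h1 with h3 | h3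
      · exact hbase ha hb hab h3 (by omega)
      · exact hbase hb ha (fun c hc => (hab c hc).symm) (by omega) h3

theorem mk_expansionsOf_eq_two {q x : ℝ} (hq : 1 < q) {a b : ℕ → ℕ}
    (ha : IsOnlyExpansion q (q * x) a) (hb : IsOnlyExpansion q (q * x - 1) b) :
    Cardinal.mk (expansionsOf q x) = (2 : ℕ) := by
  have hset : expansionsOf q x = {consDigit 0 a, consDigit 1 b} := by
    ext c
    simp only [expansionsOf, Set.mem_ofPred_eq, Set.mem_insert_iff, Set.mem_singleton_iff]
    constructor
    · intro hc
      obtain ⟨h1, h2⟩ := (isExpansion_iff_tail hq).1 hc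
      rcases Nat.le_one_iff_eq_zero_or_eq_one.1 h1 with h3 | h3
      · left
        rw [h3, Nat.cast_zero, sub_zero] at h2
        funext n
        cases n with
        | zero => exact h3
        | succ n => exact congrFun (ha.2 _ h2) n
      · right
        rw [h3, Nat.cast_one] at h2
        funext n
        cases n with
        | zero => exact h3
        | succ n => exact congrFun (hb.2 _ h2) n
    · rintro (rfl | rfl)
      · exact isExpansion_cons hq zero_le_one (by simpa using ha.1)
      · exact isExpansion_cons hq le_rfl (by simpa using hb.1)
  have hne : (consDigit 0 a : ℕ → ℕ) ≠ consDigit 1 b := fun h =>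
    absurd (congrFun h 0) zero_ne_one
  rw [hset]
  rw [Cardinal.mk_insert (by simpa using hne), Cardinal.mk_singleton]
  norm_num

theorem mem_B_two_of_quartic {q : ℝ} (hG : (1 + Real.sqrt 5) / 2 < q) (hq2 : q < 2)
    (hq : 1 < q) (hG' : 0 < q ^ 2 - q - 1) (h : q ^ 4 = 2 * q ^ 2 + q + 1) : q ∈ B 2 := by
  have h0 : 0 < q := by linarith
  have h1 : 0 < q - 1 := by linarith
  have h2 : 0 < q ^ 2 - 1 := by nlinarith
  set A := q / (q ^ 2 - 1) with hA
  have hApos : 0 < A := by positivity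
  have hA1 : A < 1 := by rw [hA, div_lt_one h2]; linarith
  have hAeq : A * (q ^ 2 - 1) = q := by rw [hA]; field_simp
  have hU := isOnlyExpansion_alternating hq hG'
  rw [← hA] at hU
  have hdiv : ∀ k : ℕ, ∃ a, IsOnlyExpansion q (A / q ^ k) a := by
    intro k
    induction k with
    | zero => exact ⟨_, by simpa using hU⟩
    | succ k ih =>
      obtain ⟨a, ha⟩ := ih
      have he : q * (A / q ^ (k + 1)) = A / q ^ k := by field_simp; ring
      refine ⟨_, isOnlyExpansion_cons_zero hq (by rw [he]; exact ha) ?_⟩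
      rw [he]
      exact (div_le_self hApos.le (one_le_pow₀ hq.le)).trans_lt hA1
  obtain ⟨b, hb⟩ := hdiv 4
  have hone : IsOnlyExpansion q ((1 + A) / q) (consDigit 1 fun n => (n + 1) % 2) := by
    have he : q * ((1 + A) / q) = 1 + A := by field_simp
    refine isOnlyExpansion_cons_one hq (by rw [he, add_sub_cancel_left]; exact hU) ?_
    rw [he, div_lt_iff₀ h1]
    have h3 : 0 < q + 1 := by linarith
    refine lt_of_mul_lt_mul_right ?_ h3.le
    nlinarith
  have hkey : (1 + A) / q - 1 = A / q ^ 4 := by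
    rw [hA]
    field_simp
    linear_combination (1 - q) * h
  have hex : q * ((1 + A) / q / q) = (1 + A) / q := by field_simp
  have hmk := mk_expansionsOf_eq_two (x := (1 + A) / q / q) hq (by rw [hex]; exact hone)
    (by rw [hex, hkey]; exact hb)
  refine ⟨⟨hG, hq2⟩, _, ?_, hmk⟩
  have hexp : IsExpansion q ((1 + A) / q / q) _ :=
    isExpansion_cons hq zero_le_one (by rw [hex, Nat.cast_zero, sub_zero]; exact hone.1)
  exact hexp.mem_Icc hq

theorem quartic_eq_of_mem_B_two {q : ℝ} (h : q ∈ B 2) (hlo : 1.6 < q)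
    (hG : 0 < q ^ 2 - q - 1) (hf : q ^ 3 - 2 * q ^ 2 + q - 1 < 0) (hhi : q < 1.756) :
    q ^ 4 = 2 * q ^ 2 + q + 1 := by
  have hq : 1 < q := by linarith
  obtain ⟨-, x, -, hx⟩ := h
  obtain ⟨a, b, hab, hset⟩ := Cardinal.mk_eq_two_iff.1 (by exact_mod_cast hx)
  obtain ⟨n, hn⟩ := Function.ne_iff.1 fun he => hab (Subtype.ext he)
  obtain ⟨y, a', b', ha', hb'⟩ := exists_branching hq n a.2 b.2 (fun c hc => by
    have : (⟨c, hc⟩ : expansionsOf q x) ∈ ({a, b} : Set _) := hset ▸ Set.mem_univ _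
    rcases this with h | h
    · left; exact congrArg Subtype.val h
    · right; exact congrArg Subtype.val h) hn
  exact quartic_eq_of_unique_sub_eq_one hlo hG hf hhi ha' hb'

theorem golden_lt_iff {q : ℝ} (h0 : 1 < q) : (1 + Real.sqrt 5) / 2 < q ↔ 0 < q ^ 2 - q - 1 := by
  have h5 : Real.sqrt 5 ^ 2 = 5 := Real.sq_sqrt (by norm_num)
  have h6 : 0 ≤ Real.sqrt 5 := Real.sqrt_nonneg 5
  constructor <;> intro h <;> nlinarith

theorem stmt3 (q2 qf : ℝ)
    (hq2 : q2 ∈ Set.Ioo (1:ℝ) 2) (hq2eq : q2 ^ 4 = 2 * q2 ^ 2 + q2 + 1)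
    (hqf : qf ∈ Set.Ioo (1:ℝ) 2) (hqfeq : qf ^ 3 = 2 * qf ^ 2 - qf + 1) :
    IsLeast (B 2) q2 ∧ B 2 ∩ Set.Ioo ((1 + Real.sqrt 5) / 2) qf = {q2} := by
  obtain ⟨h1, h2⟩ := hq2
  obtain ⟨h3, h4⟩ := hqf
  have h0 : 0 < q2 := by linarith
  have hlo : 1.71 < q2 := by
    by_contra! hle
    have h := mul_nonneg (sub_nonneg.2 h1.le) (sub_nonneg.2 hle)
    nlinarith [mul_nonneg h h0.le, mul_nonneg h (pow_pos h0 2).le]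
  have hhi : q2 < 1.72 := by
    by_contra! hle
    have h := sub_nonneg.2 hle
    nlinarith [mul_nonneg h h0.le, mul_nonneg h (pow_pos h0 2).le, mul_nonneg h (pow_pos h0 3).le]
  have hflo : 1.75 < qf := by
    by_contra! hle
    nlinarith [mul_pos (sub_pos.2 h3) (sub_pos.2 h3)]
  have hfhi : qf < 1.756 := by
    by_contra! hle
    nlinarith [mul_pos (sub_pos.2 h3) (sub_pos.2 h3)]
  have hG : 0 < q2 ^ 2 - q2 - 1 := by nlinarith
  have hmem : q2 ∈ B 2 :=
    mem_B_two_of_quartic ((golden_lt_iff h1).2 hG) h2 h1 hG hq2eq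
  have huniq : ∀ q ∈ B 2, q < qf → q = q2 := by
    intro q hq hlt
    have hG1 : (1 + Real.sqrt 5) / 2 < q := hq.1.1
    have h5 : (2.2 : ℝ) < Real.sqrt 5 := Real.lt_sqrt_of_sq_lt (by norm_num)
    have h6 : 1.6 < q := by linarith
    have h7 : 1 < q := by linarith
    have hf : q ^ 3 - 2 * q ^ 2 + q - 1 < 0 := by
      have : 0 < (qf - q) * (qf ^ 2 + qf * q + q ^ 2 - 2 * (qf + q) + 1) :=
        mul_pos (by linarith) (by nlinarith)
      nlinarith
    have he := quartic_eq_of_mem_B_two hq h6 ((golden_lt_iff h7).1 hG1) hf (by linarith)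
    have h8 : (q - q2) * ((q + q2) * (q ^ 2 + q2 ^ 2 - 2) - 1) = 0 := by
      linear_combination he - hq2eq
    have h9 : 0 < (q + q2) * (q ^ 2 + q2 ^ 2 - 2) - 1 := by nlinarith
    linarith [(mul_eq_zero.1 h8).resolve_right h9.ne']
  refine ⟨⟨hmem, fun q hq => ?_⟩, Set.eq_singleton_iff_unique_mem.2
    ⟨⟨hmem, hmem.1.1, by linarith⟩, fun q hq => huniq q hq.1 hq.2.2⟩⟩
  by_contra! hlt
  exact hlt.ne (huniq q hq (by linarith))
end
end
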